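/- Let f = h + conj(g) ∈ M(α) with |α| ≤ 1, h(z) = z + Σ_{n≥2} aₙzⁿ. The area of f(𝔻), given by ∬_𝔻 (|h'|² - |g'|²) dx dy, equals π(1 - |α|²/2) + π·Σ_{n≥2} (n - n²|α|²/(n+1))|aₙ|². In particular the area is ≥ π(1 - |α|²/2), with equality iff aₙ = 0 for all n ≥ 2. -/

import Mathlib

open Complex Metric Real MeasureTheory

lemma aux_congr {ι E : Type*} [AddCommMonoid E] [TopologicalSpace E] {f g : ι → E} {s : E}
    (h : ∀ n, f n = g n) (hf : HasSum f s) : HasSum g s := (funext h : f = g) ▸ hf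

lemma aux_exp_int (m n : ℕ) :
    (∫ θ in (-π)..π, Complex.exp (((m : ℂ) - n) * I * θ)) = if m = n then (2 * π : ℂ) else 0 := by
  split_ifs with h
  · subst h
    simp
    ring
  · have hne : ((m : ℂ) - n) * I ≠ 0 := by
      refine mul_ne_zero (sub_ne_zero.mpr (by exact_mod_cast h)) I_ne_zero
    rw [integral_exp_mul_complex hne, div_eq_zero_iff]
    left
    rw [sub_eq_zero, Complex.exp_eq_exp_iff_exists_int]
    refine ⟨(m : ℤ) - n, ?_⟩
    push_cast
    ring

lemma aux_parseval (b : ℕ → ℂ) (hb : Summable fun n => ‖b n‖) (G : ℝ → ℂ)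
    (hG : ∀ θ : ℝ, HasSum (fun n : ℕ => b n * Complex.exp (n * I * θ)) (G θ)) :
    HasSum (fun n => 2 * π * ‖b n‖ ^ 2) (∫ θ in (-π)..π, ‖G θ‖ ^ 2) := by
  have hnorm : ∀ (n : ℕ) (θ : ℝ), ‖Complex.exp (n * I * θ)‖ = 1 := by
    intro n θ
    rw [show (n : ℂ) * I * θ = ((n * θ : ℝ) : ℂ) * I by push_cast; ring]
    exact Complex.norm_exp_ofReal_mul_I _
  have hpair : Summable (fun p : ℕ × ℕ => ‖b p.1‖ * ‖b p.2‖) :=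
    hb.mul_of_nonneg hb (fun _ => norm_nonneg _) (fun _ => norm_nonneg _)
  have key : HasSum (fun p : ℕ × ℕ => ∫ θ in (-π)..π,
      (b p.1 * starRingEnd ℂ (b p.2)) * Complex.exp (((p.1 : ℂ) - p.2) * I * θ))
      (∫ θ in (-π)..π, ((‖G θ‖ ^ 2 : ℝ) : ℂ)) := by
    refine intervalIntegral.hasSum_integral_of_dominated_convergence
      (fun p _ => ‖b p.1‖ * ‖b p.2‖) ?_ ?_ ?_ ?_ ?_
    · intro p
      exact Continuous.aestronglyMeasurable (by fun_prop)
    · intro p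
      refine Filter.Eventually.of_forall fun θ _ => ?_
      have : ‖Complex.exp (((p.1 : ℂ) - p.2) * I * θ)‖ = 1 := by
        rw [show ((p.1 : ℂ) - p.2) * I * θ = (((p.1 - p.2) * θ : ℝ) : ℂ) * I by push_cast; ring]
        exact Complex.norm_exp_ofReal_mul_I _
      simp [this]
    · exact Filter.Eventually.of_forall fun θ _ => hpair
    · simp
    · refine Filter.Eventually.of_forall fun θ _ => ?_
      have h1 := hG θ
      have h2 : HasSum (fun n : ℕ => starRingEnd ℂ (b n * Complex.exp (n * I * θ)))
          (starRingEnd ℂ (G θ)) := Complex.hasSum_conj'.mpr (by simpa using h1)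
      have h3 := h1.mul h2 (by
        apply Summable.of_norm
        refine hpair.congr fun p => ?_
        simp [hnorm])
      rw [Complex.mul_conj, Complex.normSq_eq_norm_sq] at h3
      refine aux_congr ?_ (h3)
      intro p
      rw [map_mul, ← Complex.exp_conj]
      simp only [map_mul, conj_ofReal, conj_I, map_natCast]
      rw [show ((p.1 : ℂ) - p.2) * I * θ = p.1 * I * θ + p.2 * -I * θ by ring, Complex.exp_add]
      ring
  simp_rw [intervalIntegral.integral_const_mul, aux_exp_int] at key
  rw [intervalIntegral.integral_ofReal] at key
  have hinj : Function.Injective (fun n : ℕ => (n, n)) := fun a b h => (Prod.mk.inj h).1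
  rw [← hinj.hasSum_iff] at key
  · rw [← Complex.hasSum_ofReal]
    refine aux_congr ?_ (key)
    intro n
    simp [Complex.mul_conj, Complex.normSq_eq_norm_sq]
    ring
  · intro p hp
    have : p.1 ≠ p.2 := fun h => hp ⟨p.1, Prod.ext rfl h⟩
    simp [this]

lemma aux_circle (c : ℕ → ℂ) (F : ℂ → ℂ) (hcont : ContinuousOn F (ball 0 1))
    (hF : ∀ z ∈ ball (0 : ℂ) 1, HasSum (fun n => c n * z ^ n) (F z)) (r : ℝ) (hr0 : 0 < r)
    (hr1 : r < 1) :
    ∫⁻ θ in Set.Ioo (-π) π, ENNReal.ofReal (‖F (r * (Real.cos θ + Real.sin θ * I))‖ ^ 2) =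
      ∑' n, ENNReal.ofReal (2 * π * ‖c n‖ ^ 2 * r ^ (2 * n)) := by
  have hrb : (r : ℂ) ∈ ball (0 : ℂ) 1 := by simp [abs_of_pos hr0, hr1]
  have hE : ∀ θ : ℝ, (Real.cos θ + Real.sin θ * I : ℂ) = Complex.exp (θ * I) := by
    intro θ; rw [Complex.exp_mul_I]; simp
  simp_rw [hE]
  have hmem : ∀ θ : ℝ, (r : ℂ) * Complex.exp (θ * I) ∈ ball (0 : ℂ) 1 := by
    intro θ
    simp [Complex.norm_exp_ofReal_mul_I, abs_of_pos hr0, hr1]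
  have hb : Summable fun n => ‖c n * (r : ℂ) ^ n‖ := (hF r hrb).summable.norm
  have hP := aux_parseval (fun n => c n * (r : ℂ) ^ n) hb
    (fun θ => F (r * Complex.exp (θ * I))) (by
      intro θ
      refine aux_congr ?_ ((hF _ (hmem θ)))
      intro n
      rw [mul_pow, ← Complex.exp_nat_mul, show (n : ℂ) * I * θ = n * (θ * I) by ring]
      ring)
  have hc : Continuous fun θ : ℝ => ‖F (r * Complex.exp (θ * I))‖ ^ 2 := by
    refine (Continuous.norm ?_).pow 2
    exact hcont.comp_continuous (by fun_prop) hmem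
  rw [← ofReal_integral_eq_lintegral_ofReal, ← integral_Ioc_eq_integral_Ioo,
    ← intervalIntegral.integral_of_le (by linarith [pi_pos]), ← hP.tsum_eq,
    ENNReal.ofReal_tsum_of_nonneg (fun n => by positivity) hP.summable]
  · congr 1; ext n; congr 1
    simp [abs_of_pos hr0]; ring
  · exact (hc.integrableOn_Icc (a := -π) (b := π)).mono_set Set.Ioo_subset_Icc_self
  · exact Filter.Eventually.of_forall fun θ => by positivity

lemma aux_radial (n : ℕ) (C : ℝ) (hC : 0 ≤ C) :
    ∫⁻ r in Set.Ioo (0 : ℝ) 1, ENNReal.ofReal r * ENNReal.ofReal (2 * π * C * r ^ (2 * n)) =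
      ENNReal.ofReal (π * (C / (n + 1))) := by
  have : ∀ r ∈ Set.Ioo (0 : ℝ) 1, ENNReal.ofReal r * ENNReal.ofReal (2 * π * C * r ^ (2 * n))
      = ENNReal.ofReal (2 * π * C * r ^ (2 * n + 1)) := by
    intro r hr
    rw [← ENNReal.ofReal_mul hr.1.le]
    congr 1; ring
  rw [setLIntegral_congr_fun measurableSet_Ioo this, ← ofReal_integral_eq_lintegral_ofReal,
    ← integral_Ioc_eq_integral_Ioo, ← intervalIntegral.integral_of_le zero_le_one,
    intervalIntegral.integral_const_mul, integral_pow]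
  · congr 1
    push_cast
    field_simp
    simp
    ring
  · exact ((by fun_prop : Continuous fun r : ℝ => 2 * π * C * r ^ (2 * n + 1)).integrableOn_Icc
      (a := 0) (b := 1)).mono_set Set.Ioo_subset_Icc_self
  · refine (ae_restrict_iff' measurableSet_Ioo).mpr (Filter.Eventually.of_forall fun r hr => ?_)
    have := hr.1
    simp only [Pi.zero_apply]
    positivity

lemma aux_area (c : ℕ → ℂ) (F : ℂ → ℂ) (hcont : ContinuousOn F (ball 0 1))
    (hF : ∀ z ∈ ball (0 : ℂ) 1, HasSum (fun n => c n * z ^ n) (F z)) :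
    ∫⁻ z in ball (0 : ℂ) 1, ENNReal.ofReal (‖F z‖ ^ 2) =
      ∑' n : ℕ, ENNReal.ofReal (π * (‖c n‖ ^ 2 / (n + 1))) := by
  classical
  set f : ℂ → ENNReal := (ball (0 : ℂ) 1).indicator fun z => ENNReal.ofReal (‖F z‖ ^ 2) with hf
  have hfm : Measurable f := by
    have : Measurable ((ball (0 : ℂ) 1).piecewise F 0) :=
      hcont.measurable_piecewise continuousOn_const measurableSet_ball
    have h2 : f = fun z => ENNReal.ofReal (‖(ball (0 : ℂ) 1).piecewise F 0 z‖ ^ 2) := by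
      ext z
      by_cases hz : z ∈ ball (0 : ℂ) 1
      · simp only [hf, Set.indicator_of_mem hz, Set.piecewise_eq_of_mem _ _ _ hz]
      · simp only [hf, Set.indicator_of_notMem hz, Set.piecewise_eq_of_notMem _ _ _ hz]
        simp
    rw [h2]
    fun_prop
  rw [← lintegral_indicator measurableSet_ball, ← hf, ← Complex.lintegral_comp_polarCoord_symm]
  simp_rw [Complex.polarCoord_symm_apply]
  rw [show polarCoord.target = Set.Ioi (0 : ℝ) ×ˢ Set.Ioo (-π) π from rfl,
    Measure.volume_eq_prod, setLIntegral_prod]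
  swap
  · apply Measurable.aemeasurable
    simp only [smul_eq_mul]
    apply Measurable.mul (by fun_prop)
    exact hfm.comp (by fun_prop)
  have hr : ∀ r ∈ Set.Ioi (0 : ℝ), (∫⁻ θ in Set.Ioo (-π) π,
      ENNReal.ofReal r • f (r * (Real.cos θ + Real.sin θ * I))) =
      (Set.Ioo (0 : ℝ) 1).indicator (fun r => ∑' n, ENNReal.ofReal r *
        ENNReal.ofReal (2 * π * ‖c n‖ ^ 2 * r ^ (2 * n))) r := by
    intro r hr
    have hr0 : 0 < r := hr
    have hn : ∀ θ : ℝ, ‖(r : ℂ) * (Real.cos θ + Real.sin θ * I)‖ = r := by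
      intro θ
      rw [show (Real.cos θ + Real.sin θ * I : ℂ) = Complex.exp (θ * I) by
        rw [Complex.exp_mul_I]; simp, norm_mul, Complex.norm_exp_ofReal_mul_I]
      simp [abs_of_pos hr0]
    by_cases h1 : r < 1
    · rw [Set.indicator_of_mem (show r ∈ Set.Ioo (0 : ℝ) 1 from ⟨hr0, h1⟩), ENNReal.tsum_mul_left, ← aux_circle c F hcont hF r hr0 h1]
      simp only [smul_eq_mul]
      rw [lintegral_const_mul' _ _ ENNReal.ofReal_ne_top]
      congr 1
      refine lintegral_congr fun θ => ?_
      rw [hf, Set.indicator_of_mem]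
      rw [mem_ball_zero_iff, hn]; exact h1
    · rw [Set.indicator_of_notMem (fun h => h1 h.2)]
      rw [lintegral_eq_zero_of_ae_eq_zero]
      refine Filter.Eventually.of_forall fun θ => ?_
      simp only [hf, Pi.zero_apply]
      rw [Set.indicator_of_notMem, smul_zero]
      rw [mem_ball_zero_iff, hn]; exact h1
  rw [setLIntegral_congr_fun measurableSet_Ioi hr, lintegral_indicator measurableSet_Ioo,
    Measure.restrict_restrict measurableSet_Ioo,
    Set.inter_eq_left.mpr (fun x hx => hx.1), lintegral_tsum]
  · congr 1; ext n
    exact aux_radial n _ (by positivity)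
  · intro n
    apply Measurable.aemeasurable
    fun_prop

lemma aux_area_real (c : ℕ → ℂ) (F : ℂ → ℂ) (hcont : ContinuousOn F (ball 0 1))
    (hF : ∀ z ∈ ball (0 : ℂ) 1, HasSum (fun n => c n * z ^ n) (F z)) (s : ℝ)
    (hs : HasSum (fun n : ℕ => ‖c n‖ ^ 2 / ((n : ℝ) + 1)) s) :
    IntegrableOn (fun z => ‖F z‖ ^ 2) (ball (0 : ℂ) 1) ∧
    ∫ z in ball (0 : ℂ) 1, ‖F z‖ ^ 2 = π * s := by
  have hs' := hs.mul_left π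
  have h0 : ∀ n : ℕ, 0 ≤ π * (‖c n‖ ^ 2 / ((n : ℝ) + 1)) := fun n => by positivity
  have hl := aux_area c F hcont hF
  rw [← ENNReal.ofReal_tsum_of_nonneg h0 hs'.summable, hs'.tsum_eq] at hl
  have hm : AEStronglyMeasurable (fun z => ‖F z‖ ^ 2) (volume.restrict (ball (0 : ℂ) 1)) :=
    (hcont.norm.pow 2).aestronglyMeasurable measurableSet_ball
  have hnn : 0 ≤ᵐ[volume.restrict (ball (0 : ℂ) 1)] fun z => ‖F z‖ ^ 2 :=
    Filter.Eventually.of_forall fun z => by positivity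
  constructor
  · refine ⟨hm, ?_⟩
    rw [hasFiniteIntegral_iff_ofReal hnn, hl]
    exact ENNReal.ofReal_lt_top
  · rw [integral_eq_lintegral_of_nonneg_ae hnn hm, hl, ENNReal.toReal_ofReal (hs'.nonneg h0)]

theorem stmt11
    (h g : ℂ → ℂ) (α : ℂ) (hα : ‖α‖ ≤ 1)
    (hha : AnalyticOn ℂ h (ball (0 : ℂ) 1))
    (hga : AnalyticOn ℂ g (ball (0 : ℂ) 1))
    (h0 : h 0 = 0) (h1 : deriv h 0 = 1) (g0 : g 0 = 0)
    (hderiv : ∀ z ∈ ball (0 : ℂ) 1, deriv g z = α * z * deriv h z)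
    (hre : ∀ z ∈ ball (0 : ℂ) 1,
      (1 + z * deriv (deriv h) z / deriv h z).re > -(1 / 2))
    (a : ℕ → ℂ)
    (ha : ∀ n, a n = iteratedDeriv n h 0 / (n.factorial : ℂ))
    (hsum : Summable fun k : ℕ => ((k : ℝ) + 2) * ‖a (k + 2)‖ ^ 2) :
    (∫ z in ball (0 : ℂ) 1, (‖deriv h z‖ ^ 2 - ‖deriv g z‖ ^ 2))
        = π * (1 - ‖α‖ ^ 2 / 2) +
          π * ∑' k : ℕ, (((k : ℝ) + 2) -
            ((k : ℝ) + 2) ^ 2 * ‖α‖ ^ 2 / ((k : ℝ) + 3)) * ‖a (k + 2)‖ ^ 2 ∧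
      (∫ z in ball (0 : ℂ) 1, (‖deriv h z‖ ^ 2 - ‖deriv g z‖ ^ 2))
        ≥ π * (1 - ‖α‖ ^ 2 / 2) ∧
      ((∫ z in ball (0 : ℂ) 1, (‖deriv h z‖ ^ 2 - ‖deriv g z‖ ^ 2))
        = π * (1 - ‖α‖ ^ 2 / 2) ↔ ∀ n : ℕ, 2 ≤ n → a n = 0) := by
  have hd : DifferentiableOn ℂ h (ball 0 1) := hha.differentiableOn
  have hd' : DifferentiableOn ℂ (deriv h) (ball 0 1) := hd.deriv isOpen_ball
  have hit : ∀ n, iteratedDeriv n h 0 = n.factorial * a n := by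
    intro n
    rw [ha n]
    have : (n.factorial : ℂ) ≠ 0 := by exact_mod_cast n.factorial_ne_zero
    field_simp
  have a1 : a 1 = 1 := by rw [ha 1]; simp [h1]
  have hT : ∀ z ∈ ball (0 : ℂ) 1,
      HasSum (fun n : ℕ => (((n : ℂ) + 1) * a (n + 1)) * z ^ n) (deriv h z) := by
    intro z hz
    have := Complex.hasSum_taylorSeries_on_ball hd' hz
    refine aux_congr ?_ (this)
    intro n
    rw [← iteratedDeriv_succ', hit, Nat.factorial_succ]
    have : (n.factorial : ℂ) ≠ 0 := by exact_mod_cast n.factorial_ne_zero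
    simp only [sub_zero, smul_eq_mul]
    push_cast
    field_simp
  set d : ℕ → ℂ := fun n => match n with
    | 0 => 0
    | n + 1 => α * (((n : ℂ) + 1) * a (n + 1)) with hddef
  have hTg : ∀ z ∈ ball (0 : ℂ) 1, HasSum (fun n : ℕ => d n * z ^ n) (deriv g z) := by
    intro z hz
    rw [hderiv z hz, ← hasSum_nat_add_iff' 1]
    simp only [Finset.sum_range_one, hddef, zero_mul, sub_zero]
    refine aux_congr ?_ (((hT z hz).mul_left (α * z)))
    intro n
    ring
  have hcg : ContinuousOn (deriv g) (ball 0 1) := by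
    have : ContinuousOn (fun z => α * z * deriv h z) (ball 0 1) :=
      (continuousOn_const.mul continuousOn_id).mul hd'.continuousOn
    exact this.congr hderiv
  have hsum2 : Summable fun k : ℕ =>
      ((k : ℝ) + 2) ^ 2 * ‖α‖ ^ 2 / ((k : ℝ) + 3) * ‖a (k + 2)‖ ^ 2 := by
    refine Summable.of_nonneg_of_le (fun k => by positivity) (fun k => ?_) hsum
    refine mul_le_mul_of_nonneg_right ?_ (by positivity)
    rw [div_le_iff₀ (by positivity)]
    have : ‖α‖ ^ 2 ≤ 1 := pow_le_one₀ (norm_nonneg _) hα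
    have hk : (0 : ℝ) ≤ k := k.cast_nonneg
    nlinarith [mul_le_mul_of_nonneg_left this (by positivity : (0 : ℝ) ≤ ((k : ℝ) + 2) ^ 2)]
  have hS1 : HasSum (fun n : ℕ => ‖((n : ℂ) + 1) * a (n + 1)‖ ^ 2 / ((n : ℝ) + 1))
      (1 + ∑' k : ℕ, ((k : ℝ) + 2) * ‖a (k + 2)‖ ^ 2) := by
    rw [← hasSum_nat_add_iff' 1]
    simp only [Finset.sum_range_one]
    have e : (1 + ∑' k : ℕ, ((k : ℝ) + 2) * ‖a (k + 2)‖ ^ 2) -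
      ‖(((0 : ℕ) : ℂ) + 1) * a (0 + 1)‖ ^ 2 / (((0 : ℕ) : ℝ) + 1) =
        ∑' k : ℕ, ((k : ℝ) + 2) * ‖a (k + 2)‖ ^ 2 := by simp [a1]
    rw [e]
    refine aux_congr ?_ (hsum.hasSum)
    intro k
    have : ‖((k + 1 : ℕ) : ℂ) + 1‖ = (k : ℝ) + 2 := by
      rw [show ((k + 1 : ℕ) : ℂ) + 1 = ((k + 2 : ℕ) : ℂ) by push_cast; ring, Complex.norm_natCast]
      push_cast; ring
    rw [norm_mul, this]
    push_cast
    field_simp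
    ring
  have hS2 : HasSum (fun n : ℕ => ‖d n‖ ^ 2 / ((n : ℝ) + 1))
      (‖α‖ ^ 2 / 2 + ∑' k : ℕ,
        ((k : ℝ) + 2) ^ 2 * ‖α‖ ^ 2 / ((k : ℝ) + 3) * ‖a (k + 2)‖ ^ 2) := by
    rw [← hasSum_nat_add_iff' 2]
    have e : (‖α‖ ^ 2 / 2 + ∑' k : ℕ,
        ((k : ℝ) + 2) ^ 2 * ‖α‖ ^ 2 / ((k : ℝ) + 3) * ‖a (k + 2)‖ ^ 2) -
        ∑ i ∈ Finset.range 2, ‖d i‖ ^ 2 / ((i : ℝ) + 1) = ∑' k : ℕ,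
        ((k : ℝ) + 2) ^ 2 * ‖α‖ ^ 2 / ((k : ℝ) + 3) * ‖a (k + 2)‖ ^ 2 := by
      simp [Finset.sum_range_succ, hddef, a1]
      norm_num
    rw [e]
    refine aux_congr ?_ (hsum2.hasSum)
    intro k
    have : ‖((k + 1 : ℕ) : ℂ) + 1‖ = (k : ℝ) + 2 := by
      rw [show ((k + 1 : ℕ) : ℂ) + 1 = ((k + 2 : ℕ) : ℂ) by push_cast; ring, Complex.norm_natCast]
      push_cast; ring
    simp only [hddef]
    rw [norm_mul, norm_mul, this]
    push_cast
    field_simp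
    ring
  obtain ⟨i1, e1⟩ := aux_area_real _ _ hd'.continuousOn hT _ hS1
  obtain ⟨i2, e2⟩ := aux_area_real _ _ hcg hTg _ hS2
  have hmain : (∫ z in ball (0 : ℂ) 1, (‖deriv h z‖ ^ 2 - ‖deriv g z‖ ^ 2))
        = π * (1 - ‖α‖ ^ 2 / 2) +
          π * ∑' k : ℕ, (((k : ℝ) + 2) -
            ((k : ℝ) + 2) ^ 2 * ‖α‖ ^ 2 / ((k : ℝ) + 3)) * ‖a (k + 2)‖ ^ 2 := by
    rw [integral_sub i1 i2, e1, e2]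
    simp_rw [sub_mul]
    rw [hsum.tsum_sub hsum2]
    ring
  have hpos : ∀ k : ℕ, 0 < ((k : ℝ) + 2) - ((k : ℝ) + 2) ^ 2 * ‖α‖ ^ 2 / ((k : ℝ) + 3) := by
    intro k
    rw [sub_pos, div_lt_iff₀ (by positivity)]
    have : ‖α‖ ^ 2 ≤ 1 := pow_le_one₀ (norm_nonneg _) hα
    have hk : (0 : ℝ) ≤ k := k.cast_nonneg
    nlinarith [mul_le_mul_of_nonneg_left this (by positivity : (0 : ℝ) ≤ ((k : ℝ) + 2) ^ 2)]
  have hnn : ∀ k : ℕ, 0 ≤ (((k : ℝ) + 2) -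
            ((k : ℝ) + 2) ^ 2 * ‖α‖ ^ 2 / ((k : ℝ) + 3)) * ‖a (k + 2)‖ ^ 2 :=
    fun k => mul_nonneg (hpos k).le (by positivity)
  have hsm : Summable fun k : ℕ => (((k : ℝ) + 2) -
            ((k : ℝ) + 2) ^ 2 * ‖α‖ ^ 2 / ((k : ℝ) + 3)) * ‖a (k + 2)‖ ^ 2 := by
    simp_rw [sub_mul]
    exact hsum.sub hsum2
  refine ⟨hmain, ?_, ?_⟩
  · rw [hmain]
    have := mul_nonneg pi_pos.le (hsm.hasSum.nonneg hnn)
    linarith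
  · rw [hmain]
    constructor
    · intro he n hn
      have h0 : ∑' k : ℕ, (((k : ℝ) + 2) -
            ((k : ℝ) + 2) ^ 2 * ‖α‖ ^ 2 / ((k : ℝ) + 3)) * ‖a (k + 2)‖ ^ 2 = 0 := by
        have : π * ∑' k : ℕ, (((k : ℝ) + 2) -
            ((k : ℝ) + 2) ^ 2 * ‖α‖ ^ 2 / ((k : ℝ) + 3)) * ‖a (k + 2)‖ ^ 2 = 0 := by linarith
        exact (mul_eq_zero.mp this).resolve_left pi_ne_zero
      have h2 := (hasSum_zero_iff_of_nonneg hnn).mp (h0 ▸ hsm.hasSum)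
      obtain ⟨k, rfl⟩ := Nat.exists_eq_add_of_le' hn
      have h3 := congrFun h2 k
      simp only [Pi.zero_apply] at h3
      have h4 := (mul_eq_zero.mp h3).resolve_left (hpos k).ne'
      simpa using h4
    · intro hz
      have : ∀ k : ℕ, a (k + 2) = 0 := fun k => hz _ (by omega)
      simp [this]
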